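/- Let L > 0, C > 0, ε > 0. Let φ : ℝ → ℂ be a Schwartz function, let S, S_b : ℝ → ℂ be bounded continuous functions, and let B ⊆ ℝ be a closed set such that S(ξ) = S_b(ξ) for all ξ ∈ B. Define ψ = 𝓕⁻¹(S·𝓕φ) and ψ_b = 𝓕⁻¹(S_b·𝓕φ) (these are bounded continuous functions since 𝓕φ is Schwartz, so S·𝓕φ and S_b·𝓕φ lie in L¹(ℝ)). Assume the pointwise decay |ψ(x)| ≤ C(1+|x|)^{−(1+ε)} and |ψ_b(x)| ≤ C(1+|x|)^{−(1+ε)} for all x ∈ ℝ. Let φ̂_L(ξ) = (1/(2L))∫_ℝ φ(y)e^{−iξy} dy. Then ‖ψ − Σ_{k∈ℤ} e^{iπk(·)/L} S_b(πk/L) φ̂_L(πk/L)‖_{L²([−L,L])} ≤ Σ_{n∈ℤ, n≠0} ‖ψ‖_{L²([2Ln−L, 2Ln+L])} + Σ_{n∈ℤ} ‖ψ − ψ_b‖_{L²([2Ln−L, 2Ln+L])}. -/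

import Mathlib

open MeasureTheory Real Complex Set
open scoped ENNReal

noncomputable section

/-- Fourier transform with the convention f̂(ξ) = (2π)^{-1/2} ∫ f(x) e^{-iξx} dx. -/
def ft (f : ℝ → ℂ) (ξ : ℝ) : ℂ :=
  (Real.sqrt (2*Real.pi) : ℂ)⁻¹ * ∫ x : ℝ, Complex.exp (-(Complex.I * ξ * x)) * f x

/-- Inverse Fourier transform with the convention (2π)^{-1/2} ∫ g(ξ) e^{iξx} dξ. -/
def ift (g : ℝ → ℂ) (x : ℝ) : ℂ :=
  (Real.sqrt (2*Real.pi) : ℂ)⁻¹ * ∫ ξ : ℝ, Complex.exp (Complex.I * ξ * x) * g ξ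

open scoped FourierTransform

/-- Minkowski's inequality for pointwise convergent series. -/
theorem eLpNorm_tsum_le {α : Type*} [MeasurableSpace α] {μ : Measure α} {p : ℝ≥0∞} (hp : 1 ≤ p)
    {f : ℤ → α → ℂ} (hf : ∀ n, AEStronglyMeasurable (f n) μ)
    (hsum : ∀ x, Summable fun n => f n x) :
    eLpNorm (fun x => ∑' n, f n x) p μ ≤ ∑' n, eLpNorm (f n) p μ := by
  let e : ℕ ≃ ℤ := (Denumerable.eqv ℤ).symm
  have hlim : ∀ x, Filter.Tendsto (fun N => (∑ i ∈ Finset.range N, f (e i)) x) Filter.atTop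
      (nhds (∑' n, f n x)) := by
    intro x
    simpa [Function.comp_def] using
      ((e.hasSum_iff (f := fun n => f n x)).2 (hsum x).hasSum).tendsto_sum_nat
  refine (Lp.eLpNorm_lim_le_liminf_eLpNorm
    (fun N => Finset.aestronglyMeasurable_sum _ fun i _ => hf (e i)) _
    (Filter.Eventually.of_forall hlim)).trans ?_
  refine (Filter.liminf_le_liminf (v := fun _ => ∑' n, eLpNorm (f n) p μ)
    (Filter.Eventually.of_forall fun N => ?_)).trans_eq (Filter.liminf_const _)
  refine (eLpNorm_sum_le (fun i _ => hf (e i)) hp).trans ?_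
  rw [← e.tsum_eq (fun n => eLpNorm (f n) p μ)]
  exact ENNReal.sum_le_tsum _

theorem eLpNorm_comp_add_right_restrict_Icc {f : ℝ → ℂ} (hf : Continuous f) (p : ℝ≥0∞)
    (a b c : ℝ) :
    eLpNorm (fun x => f (x + c)) p (volume.restrict (Icc a b)) =
      eLpNorm f p (volume.restrict (Icc (c + a) (c + b))) := by
  have h := (measurePreserving_add_right (volume : Measure ℝ) c).restrict_preimage
    (measurableSet_Icc (a := c + a) (b := c + b))
  rw [Set.preimage_add_const_Icc, add_sub_cancel_left, add_sub_cancel_left] at h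
  exact eLpNorm_comp_measurePreserving hf.aestronglyMeasurable h

theorem ft_two_pi_mul (f : ℝ → ℂ) (v : ℝ) :
    ft f (2 * Real.pi * v) = (Real.sqrt (2 * Real.pi) : ℂ)⁻¹ * 𝓕 f v := by
  rw [ft, fourier_real_eq_integral_exp_smul]
  congr 2 with x
  rw [smul_eq_mul]
  congr 2
  push_cast
  ring

theorem ift_mul_ft (m f : ℝ → ℂ) :
    ift (fun ξ => m ξ * ft f ξ) = 𝓕⁻ fun v => m (2 * Real.pi * v) * 𝓕 f v := by
  ext x
  have h2 : (0 : ℝ) < 2 * Real.pi := by positivity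
  have hs : (Real.sqrt (2 * Real.pi) : ℂ) * Real.sqrt (2 * Real.pi) = 2 * Real.pi := by
    rw [← Complex.ofReal_mul, Real.mul_self_sqrt h2.le]; push_cast; rfl
  have hs0 : (Real.sqrt (2 * Real.pi) : ℂ) ≠ 0 := by
    exact_mod_cast (Real.sqrt_pos.2 h2).ne'
  have key := Measure.integral_comp_mul_left
    (fun ξ : ℝ => Complex.exp (Complex.I * ξ * x) * (m ξ * ft f ξ)) (2 * Real.pi)
  rw [abs_of_pos (inv_pos.2 h2), eq_inv_smul_iff₀ h2.ne'] at key
  rw [ift, ← key, Real.fourierInv_eq', Complex.real_smul, ← integral_const_mul,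
    ← integral_const_mul]
  congr 1 with v
  rw [ft_two_pi_mul, smul_eq_mul]
  have : Complex.exp (Complex.I * ((2 * Real.pi * v : ℝ) : ℂ) * x) =
      Complex.exp (((2 * Real.pi * inner ℝ v x : ℝ) : ℂ) * Complex.I) := by
    congr 1
    rw [Real.inner_apply]
    push_cast
    ring
  rw [this]
  push_cast
  rw [← hs]
  field_simp

theorem continuous_fourierInv_of_integrable {g : ℝ → ℂ} (hg : Integrable g) :
    Continuous (𝓕⁻ g) := by
  rw [fourierInv_eq_fourier_comp_neg]
  exact VectorFourier.fourierIntegral_continuous Real.continuous_fourierChar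
    (by fun_prop) hg.comp_neg

theorem fourier_comp_mul_left (f : ℝ → ℂ) {T : ℝ} (hT : 0 < T) (w : ℝ) :
    𝓕 (fun x => f (T * x)) w = (T : ℂ)⁻¹ * 𝓕 f (w / T) := by
  have key := Measure.integral_comp_mul_left
    (fun y : ℝ => Complex.exp (((-2 * Real.pi * y * (w / T) : ℝ) : ℂ) * Complex.I) • f y) T
  rw [fourier_real_eq_integral_exp_smul, fourier_real_eq_integral_exp_smul]
  rw [abs_of_pos (inv_pos.2 hT), Complex.real_smul] at key
  push_cast at key ⊢
  rw [← key]
  congr 1 with x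
  congr 2
  have : (T : ℂ) ≠ 0 := by exact_mod_cast hT.ne'
  field_simp

theorem isBigO_cocompact_of_decay {f : ℝ → ℂ} {C r T : ℝ} (hr : 0 < r) (hT : 0 < T)
    (hC : 0 < C) (h : ∀ x, ‖f x‖ ≤ C * (1 + |x|) ^ (-r)) :
    (fun x => f (T * x)) =O[Filter.cocompact ℝ] fun x => |x| ^ (-r) := by
  refine Asymptotics.IsBigO.of_bound (C * T ^ (-r)) ?_
  have h0 : ∀ᶠ x : ℝ in Filter.cocompact ℝ, x ≠ 0 :=
    (Filter.cocompact_le_cofinite (Set.finite_singleton (0 : ℝ)).compl_mem_cofinite)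
  filter_upwards [h0] with x hx
  have hx' : 0 < |x| := abs_pos.2 hx
  rw [Real.norm_of_nonneg (by positivity), mul_assoc, ← Real.mul_rpow hT.le hx'.le]
  refine (h _).trans (mul_le_mul_of_nonneg_left ?_ hC.le)
  refine Real.rpow_le_rpow_of_nonpos (by positivity) ?_ (by linarith)
  rw [abs_mul, abs_of_pos hT]
  linarith

theorem integrable_of_decay {f : ℝ → ℂ} (hf : Continuous f) {C r : ℝ} (hr : 1 < r)
    (h : ∀ x, ‖f x‖ ≤ C * (1 + |x|) ^ (-r)) : Integrable f :=
  ((integrable_one_add_norm (E := ℝ) (μ := volume) (r := r) (by simpa using hr)).const_mul C).mono'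
    hf.aestronglyMeasurable (Filter.Eventually.of_forall h)

/-- Poisson summation on a lattice of period `T`, with absolute convergence of the
periodization. -/
theorem hasSum_comp_add_period {f : ℝ → ℂ} (hf : Continuous f) {C r T : ℝ} (hr : 1 < r)
    (hT : 0 < T) (hC : 0 < C) (h : ∀ x, ‖f x‖ ≤ C * (1 + |x|) ^ (-r))
    (hs : Summable fun n : ℤ => 𝓕 f (n / T)) (x : ℝ) :
    HasSum (fun n : ℤ => f (x + T * n))
      (∑' k : ℤ, Complex.exp (2 * Real.pi * Complex.I * k * x / T) * ((T : ℂ)⁻¹ * 𝓕 f (k / T))) := by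
  let g : C(ℝ, ℂ) := ⟨fun x => f (T * x), by fun_prop⟩
  have hn : ∀ K : TopologicalSpace.Compacts ℝ,
      Summable fun n : ℤ => ‖(g.comp <| ContinuousMap.addRight n).restrict K‖ := fun K =>
    summable_of_isBigO (Real.summable_abs_int_rpow hr)
      ((isBigO_norm_restrict_cocompact g (zero_lt_one.trans hr)
        (isBigO_cocompact_of_decay (zero_lt_one.trans hr) hT hC h) K).comp_tendsto
          Int.tendsto_coe_cofinite)
  have hF : ∀ w : ℝ, 𝓕 (g : ℝ → ℂ) w = (T : ℂ)⁻¹ * 𝓕 f (w / T) :=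
    fun w => fourier_comp_mul_left f hT w
  have hsum := Real.tsum_eq_tsum_fourier hn (by simpa only [hF] using hs.mul_left _) (x / T)
  have hg : ∀ n : ℤ, g (x / T + n) = f (x + T * n) := by
    intro n
    change f (T * _) = _
    congr 1
    field_simp
  simp only [hg, hF] at hsum
  have hS : Summable fun n : ℤ => f (x + T * n) := by
    refine Summable.of_norm_bounded (hn ⟨{x / T}, isCompact_singleton⟩) fun n => ?_
    rw [← hg]
    exact ((g.comp <| ContinuousMap.addRight (n : ℝ)).restrict {x / T}).norm_coe_le_norm
      ⟨x / T, rfl⟩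
  convert! hS.hasSum using 1
  rw [hsum]
  congr 1 with k
  rw [mul_comm, fourier_coe_apply]
  congr 2
  push_cast
  field_simp

/-- Poisson-summation error bound for approximating a Fourier multiplier `S(i∇)`
by a truncated Fourier series on the box [−L,L], with the multiplier `S` replaced by
`S_b` outside the closed frequency set `B`. -/
theorem stmt0 (L C ε : ℝ) (hL : 0 < L) (hC : 0 < C) (hε : 0 < ε)
    (φ : SchwartzMap ℝ ℂ) (S Sb : ℝ → ℂ)
    (hScont : Continuous S) (hSbdd : ∃ M, ∀ ξ, ‖S ξ‖ ≤ M)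
    (hSbcont : Continuous Sb) (hSbbdd : ∃ M, ∀ ξ, ‖Sb ξ‖ ≤ M)
    (B : Set ℝ) (hB : IsClosed B) (hSB : ∀ ξ ∈ B, S ξ = Sb ξ)
    (ψ ψb : ℝ → ℂ)
    (hψ : ψ = ift (fun ξ => S ξ * ft (fun x => φ x) ξ))
    (hψb : ψb = ift (fun ξ => Sb ξ * ft (fun x => φ x) ξ))
    (hdecay : ∀ x : ℝ, ‖ψ x‖ ≤ C * (1 + |x|) ^ (-(1+ε)))
    (hdecayb : ∀ x : ℝ, ‖ψb x‖ ≤ C * (1 + |x|) ^ (-(1+ε)))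
    (φhatL : ℝ → ℂ)
    (hφhat : φhatL = fun ξ : ℝ =>
      (1/(2*L) : ℂ) * ∫ y : ℝ, φ y * Complex.exp (-(Complex.I * ξ * y))) :
    eLpNorm
      (fun x : ℝ => ψ x - ∑' k : ℤ,
        Complex.exp (Complex.I * Real.pi * (k : ℂ) * (x : ℂ) / (L : ℂ))
          * Sb (Real.pi * (k : ℝ) / L) * φhatL (Real.pi * (k : ℝ) / L))
      2 (volume.restrict (Set.Icc (-L) L))
    ≤ (∑' n : {n : ℤ // n ≠ 0},
          eLpNorm ψ 2 (volume.restrict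
            (Set.Icc (2*L*((n : ℤ) : ℝ) - L) (2*L*((n : ℤ) : ℝ) + L))))
      + ∑' n : ℤ,
          eLpNorm (fun x => ψ x - ψb x) 2 (volume.restrict
            (Set.Icc (2*L*(n : ℝ) - L) (2*L*(n : ℝ) + L))) := by
  obtain ⟨M, hM⟩ := hSbbdd
  obtain ⟨M', hM'⟩ := hSbdd
  have hT : 0 < 2 * L := by positivity
  have hr : 1 < 1 + ε := by linarith
  have hFc : Continuous (𝓕 (φ : ℝ → ℂ)) := (𝓕 φ).continuous
  have hFi : Integrable (𝓕 (φ : ℝ → ℂ)) := (𝓕 φ).integrable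
  have hint : ∀ m : ℝ → ℂ, Continuous m → ∀ M, (∀ ξ, ‖m ξ‖ ≤ M) →
      Integrable fun v => m (2 * Real.pi * v) * 𝓕 (φ : ℝ → ℂ) v := fun m hm M hM =>
    hFi.bdd_mul (by fun_prop) (Filter.Eventually.of_forall fun v => hM _)
  rw [ift_mul_ft] at hψ hψb
  have hψc : Continuous ψ := hψ ▸ continuous_fourierInv_of_integrable (hint S hScont M' hM')
  have hψbc : Continuous ψb := hψb ▸ continuous_fourierInv_of_integrable (hint Sb hSbcont M hM)
  have hψbF : 𝓕 ψb = fun v => Sb (2 * Real.pi * v) * 𝓕 (φ : ℝ → ℂ) v := by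
    have hi : Integrable (𝓕⁻ fun v => Sb (2 * Real.pi * v) * 𝓕 (φ : ℝ → ℂ) v) :=
      hψb ▸ integrable_of_decay hψbc hr hdecayb
    have hi' := hi.comp_neg
    rw [hψb]
    refine Continuous.fourier_fourierInv_eq (by fun_prop) (hint Sb hSbcont M hM) ?_
    simpa only [fourierInv_eq_fourier_neg, neg_neg] using hi'
  have hcoef : Summable fun n : ℤ => 𝓕 ψb (n / (2 * L)) := by
    simp only [hψbF]
    have h1 : Summable fun n : ℤ => 𝓕 (φ : ℝ → ℂ) (n / (2 * L)) := by
      have hdec := ((𝓕 φ).isBigO_cocompact_rpow (-2)).comp_tendsto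
        ((Filter.tendsto_cocompact_mul_right₀ (inv_ne_zero hT.ne')).comp
          Int.tendsto_coe_cofinite)
      refine summable_of_isBigO ?_ hdec
      simp only [Function.comp_def, Real.norm_eq_abs, abs_mul]
      simp only [Real.mul_rpow (abs_nonneg _) (abs_nonneg _)]
      exact (Real.summable_abs_int_rpow one_lt_two).mul_right _
    refine Summable.of_norm_bounded (h1.norm.mul_left M) fun n => ?_
    rw [norm_mul]
    gcongr
    exact hM _
  have hP := hasSum_comp_add_period hψbc hr hT hC hdecayb hcoef
  have hseries : ∀ x : ℝ, (∑' k : ℤ,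
        Complex.exp (Complex.I * Real.pi * (k : ℂ) * (x : ℂ) / (L : ℂ))
          * Sb (Real.pi * (k : ℝ) / L) * φhatL (Real.pi * (k : ℝ) / L)) =
      ∑' k : ℤ, Complex.exp (2 * Real.pi * Complex.I * k * x / (2 * L : ℝ)) *
        (((2 * L : ℝ) : ℂ)⁻¹ * 𝓕 ψb (k / (2 * L))) := by
    intro x
    have hL' : (L : ℂ) ≠ 0 := by exact_mod_cast hL.ne'
    congr 1 with k
    have h1 : Real.pi * (k : ℝ) / L = 2 * Real.pi * (k / (2 * L)) := by field_simp
    have h2 : φhatL (Real.pi * (k : ℝ) / L) =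
        ((2 * L : ℝ) : ℂ)⁻¹ * 𝓕 (φ : ℝ → ℂ) (k / (2 * L)) := by
      rw [hφhat, fourier_real_eq_integral_exp_smul]
      push_cast
      rw [one_div]
      congr 2 with y
      rw [smul_eq_mul, mul_comm]
      congr 2
      field_simp
    have h3 : Complex.I * Real.pi * (k : ℂ) * (x : ℂ) / (L : ℂ) =
        2 * Real.pi * Complex.I * k * x / (2 * L : ℝ) := by
      push_cast
      field_simp
    rw [h2, hψbF, h1, h3]
    ring
  let D : ℤ → ℝ → ℂ := fun n x => ψ (x + 2 * L * n) - ψb (x + 2 * L * n)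
  let P : ℤ → ℝ → ℂ := fun n => ({0}ᶜ : Set ℤ).indicator (fun n x => ψ (x + 2 * L * n)) n
  have hDP : ∀ x, HasSum (fun n => D n x - P n x) (ψ x - ∑' k : ℤ,
        Complex.exp (Complex.I * Real.pi * (k : ℂ) * (x : ℂ) / (L : ℂ))
          * Sb (Real.pi * (k : ℝ) / L) * φhatL (Real.pi * (k : ℝ) / L)) := by
    intro x
    rw [hseries]
    convert! (hasSum_ite_eq (0 : ℤ) (ψ x)).sub (hP x) using 1
    ext n
    by_cases hn : n = 0
    · simp [D, P, hn]
    · simp [D, P, hn]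
  have hDm : ∀ n, Continuous (D n) := fun n => by fun_prop
  have hPm : ∀ n, Continuous (P n) := fun n => by
    by_cases hn : n = 0
    · simp only [P, hn, mem_compl_iff, mem_singleton_iff, not_true_eq_false, not_false_eq_true,
        indicator_of_notMem]
      exact continuous_zero
    · simp only [P, mem_compl_iff, mem_singleton_iff, hn, not_false_eq_true, indicator_of_mem]
      fun_prop
  simp only [← (hDP _).tsum_eq]
  refine (eLpNorm_tsum_le one_le_two
    (fun n => ((hDm n).sub (hPm n)).aestronglyMeasurable) fun x => (hDP x).summable).trans ?_
  refine (ENNReal.tsum_le_tsum fun n => eLpNorm_sub_le (hDm n).aestronglyMeasurable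
    (hPm n).aestronglyMeasurable one_le_two).trans ?_
  rw [ENNReal.tsum_add, add_comm]
  refine add_le_add (le_of_eq ?_) (le_of_eq ?_)
  · rw [show (∑' n : {n : ℤ // n ≠ 0}, eLpNorm ψ 2 (volume.restrict
        (Set.Icc (2*L*((n : ℤ) : ℝ) - L) (2*L*((n : ℤ) : ℝ) + L)))) = _ from
      tsum_subtype ({0}ᶜ : Set ℤ) fun n : ℤ => eLpNorm ψ 2 (volume.restrict
        (Set.Icc (2*L*(n : ℝ) - L) (2*L*(n : ℝ) + L)))]
    congr 1 with n
    by_cases hn : n = 0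
    · simp [P, hn]
    · simp only [P, mem_compl_iff, mem_singleton_iff, hn, not_false_eq_true, indicator_of_mem]
      rw [eLpNorm_comp_add_right_restrict_Icc hψc, ← sub_eq_add_neg]
  · congr 1 with n
    rw [eLpNorm_comp_add_right_restrict_Icc (f := fun x => ψ x - ψb x) (by fun_prop),
      ← sub_eq_add_neg]

end
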